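/- arXiv:2312.03784 — 2 statements merged into one kernel-verified Lean document; each statement's English description precedes it below -/
import Mathlib

section
/- For every probability distribution P on 𝒳, every E ≥ 0, and every Δ with 0 ≤ Δ ≤ Δ_max := min_{y∈𝒴} ∑_{x∈𝒳} P(x) d(x,y), the inverse Marton exponent satisfies R_M(E|Δ,P) = sup_{ν≥0} inf_{μ≥0} [ −νΔ + μE + min_{p_Y ∈ 𝒫(𝒴)} G^{(μ,ν)}(p_Y|P) ], where G^{(μ,ν)}(p_Y|P) = μ log ∑_x P(x) (∑_y p_Y(y) e^{−ν d(x,y)})^{−1/μ} if μ > 0, and G^{(0,ν)}(p_Y|P) = −log min_x ∑_y p_Y(y) e^{−ν d(x,y)}. -/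
open scoped BigOperators

/-- `p` is a probability distribution on the finite set `X`. -/
def IsDist {X : Type*} [Fintype X] (p : X → ℝ) : Prop :=
  (∀ x, 0 ≤ p x) ∧ ∑ x, p x = 1

/-- `V` is a conditional probability distribution on `Y` given `X`. -/
def IsCondDist {X Y : Type*} [Fintype Y] (V : X → Y → ℝ) : Prop :=
  ∀ x, IsDist (V x)

/-- Mutual information `I(q,V)` with the convention `0 log 0 = 0`. -/
noncomputable def mutInfo {X Y : Type*} [Fintype X] [Fintype Y]
    (q : X → ℝ) (V : X → Y → ℝ) : ℝ :=
  ∑ x, ∑ y, if q x * V x y = 0 then 0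
    else q x * V x y * Real.log (V x y / ∑ x', q x' * V x' y)

/-- The rate-distortion function `R(Δ|q)`. -/
noncomputable def rateDist {X Y : Type*} [Fintype X] [Fintype Y]
    (d : X → Y → ℝ) (Δ : ℝ) (q : X → ℝ) : ℝ :=
  sInf { r | ∃ V : X → Y → ℝ, IsCondDist V ∧
    (∑ x, ∑ y, q x * V x y * d x y) ≤ Δ ∧ r = mutInfo q V }

/-- Relative entropy `D(q‖P)` (real-valued; convention `0 log 0 = 0`). -/
noncomputable def relEnt {X : Type*} [Fintype X] (q P : X → ℝ) : ℝ :=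
  ∑ x, if q x = 0 then 0 else q x * Real.log (q x / P x)

/-- Absolute continuity: `q(x) = 0` whenever `P(x) = 0` (finiteness of `D(q‖P)`). -/
def AbsCont {X : Type*} (q P : X → ℝ) : Prop := ∀ x, P x = 0 → q x = 0

/-- Sion's minimax theorem in strict-inequality form. -/
theorem exists_forall_lt_of_forall_exists_lt
    {E F : Type*} {A : Set E} {B : Set F} {f : E → F → ℝ}
    [TopologicalSpace E] [AddCommGroup E] [Module ℝ E]
    [IsTopologicalAddGroup E] [ContinuousSMul ℝ E]
    [TopologicalSpace F] [AddCommGroup F] [Module ℝ F]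
    [IsTopologicalAddGroup F] [ContinuousSMul ℝ F]
    (neA : A.Nonempty) (cA : Convex ℝ A) (kA : IsCompact A) (cB : Convex ℝ B)
    (hl : ∀ y ∈ B, ContinuousOn (fun x => f x y) A)
    (hl' : ∀ y ∈ B, ConvexOn ℝ A fun x => f x y)
    (hu : ∀ x ∈ A, ContinuousOn (fun y => f x y) B)
    (hu' : ∀ x ∈ A, ConcaveOn ℝ B fun y => f x y)
    {t : ℝ} (h : ∀ x ∈ A, ∃ y ∈ B, t < f x y) :
    ∃ y ∈ B, ∀ x ∈ A, t < f x y := by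
  have hlsc : ∀ y ∈ B, LowerSemicontinuousOn (fun x => f x y) A :=
    fun y hy => (hl y hy).lowerSemicontinuousOn
  have hfin : ∃ s : Finset B, ∀ x ∈ A, ∃ i ∈ s, t < f x i := by
    rw [← LowerSemicontinuousOn.inter_biInter_preimage_Iic_eq_empty_iff_exists_finset kA hlsc]
    apply Set.eq_empty_of_forall_notMem
    rintro x ⟨hx, hx'⟩
    obtain ⟨y, hy, hlt⟩ := h x hx
    simp only [Set.mem_iInter, Set.mem_preimage, Set.mem_Iic] at hx'
    exact absurd hlt (not_lt.mpr (hx' y hy))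
  obtain ⟨s, hs⟩ := hfin
  refine Sion.exists_lt_iInf_of_lt_iInf_of_finite neA kA hlsc
    (fun y hy => (hl' y hy).quasiconvexOn) cB
    (fun x hx => (hu x hx).upperSemicontinuousOn)
    (fun x hx => (hu' x hx).quasiconcaveOn) cA
    (s.finite_toSet.image Subtype.val) (Subtype.coe_image_subset B ↑s) fun x hx => ?_
  obtain ⟨i, hi, hlt⟩ := hs x hx
  exact ⟨i, ⟨i, hi, rfl⟩, hlt⟩

theorem sub_le_mul_log_div {a b : ℝ} (ha : 0 ≤ a) (hb : 0 ≤ b) (h : b = 0 → a = 0) :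
    a - b ≤ a * Real.log (a / b) := by
  rcases ha.eq_or_lt with rfl | ha
  · simpa using hb
  have hb : 0 < b := hb.lt_of_ne fun hb => ha.ne' (h hb.symm)
  have key := mul_le_mul_of_nonneg_left (Real.one_sub_inv_le_log_of_pos (div_pos ha hb)) ha.le
  have : a * (1 - (a / b)⁻¹) = a - b := by field_simp
  linarith

/-- Gibbs' inequality on a finite set. -/
theorem sum_mul_log_div_nonneg {ι : Type*} [Fintype ι] {a b : ι → ℝ} (ha : IsDist a)
    (hb : IsDist b) (h : ∀ i, b i = 0 → a i = 0) :
    0 ≤ ∑ i, a i * Real.log (a i / b i) := by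
  have := Finset.sum_le_sum fun i (_ : i ∈ Finset.univ) =>
    sub_le_mul_log_div (ha.1 i) (hb.1 i) (h i)
  rwa [Finset.sum_sub_distrib, ha.2, hb.2, sub_self] at this

theorem convex_setOf_isCondDist {X Y : Type*} [Fintype Y] :
    Convex ℝ {V : X → Y → ℝ | IsCondDist V} := by
  intro V hV W hW a b ha hb hab x
  exact convex_stdSimplex ℝ Y (hV x) (hW x) ha hb hab

theorem isCompact_setOf_isCondDist {X Y : Type*} [Fintype Y] :
    IsCompact {V : X → Y → ℝ | IsCondDist V} := by
  have := isCompact_univ_pi fun _ : X => isCompact_stdSimplex ℝ Y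
  convert! this using 1
  ext V
  simp [IsCondDist, Set.mem_pi, stdSimplex, IsDist]

section ExpMass

variable {X Y : Type*} [Fintype Y]

/-- The mean of `exp (-ν d(x,·))` under `p`. -/
noncomputable def expMass (d : X → Y → ℝ) (ν : ℝ) (p : Y → ℝ) (x : X) : ℝ :=
  ∑ y, p y * Real.exp (-ν * d x y)

theorem expMass_pos (d : X → Y → ℝ) (ν : ℝ) {p : Y → ℝ} (hp : IsDist p) (x : X) :
    0 < expMass d ν p x := by
  obtain ⟨y, -, hy⟩ : ∃ y ∈ Finset.univ, 0 < p y :=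
    Finset.exists_lt_of_sum_lt (by simp [hp.2])
  exact Finset.sum_pos' (fun y _ => mul_nonneg (hp.1 y) (Real.exp_pos _).le)
    ⟨y, Finset.mem_univ y, mul_pos hy (Real.exp_pos _)⟩

theorem expMass_le_one {d : X → Y → ℝ} (hd : ∀ x y, 0 ≤ d x y) {ν : ℝ} (hν : 0 ≤ ν)
    {p : Y → ℝ} (hp : IsDist p) (x : X) : expMass d ν p x ≤ 1 := by
  rw [← hp.2]
  refine Finset.sum_le_sum fun y _ => mul_le_of_le_one_right (hp.1 y) (Real.exp_le_one_iff.2 ?_)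
  nlinarith [mul_nonneg hν (hd x y)]

theorem expMass_combo (d : X → Y → ℝ) (ν : ℝ) (p p' : Y → ℝ) (a b : ℝ) (x : X) :
    expMass d ν (a • p + b • p') x = a * expMass d ν p x + b * expMass d ν p' x := by
  simp only [expMass, Finset.mul_sum, ← Finset.sum_add_distrib, Pi.add_apply, Pi.smul_apply,
    smul_eq_mul]
  exact Finset.sum_congr rfl fun y _ => by ring

theorem concaveOn_log_expMass (d : X → Y → ℝ) (ν : ℝ) (x : X) :
    ConcaveOn ℝ {p : Y → ℝ | IsDist p} fun p => Real.log (expMass d ν p x) := by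
  refine ⟨convex_stdSimplex ℝ Y, fun p hp p' hp' a b ha hb hab => ?_⟩
  simp only [expMass_combo]
  exact strictConcaveOn_log_Ioi.concaveOn.2 (expMass_pos d ν hp x) (expMass_pos d ν hp' x)
    ha hb hab

theorem continuousOn_log_expMass (d : X → Y → ℝ) (ν : ℝ) (x : X) :
    ContinuousOn (fun p => Real.log (expMass d ν p x)) {p : Y → ℝ | IsDist p} :=
  ContinuousOn.log (Continuous.continuousOn (by unfold expMass; fun_prop))
    fun _ hp => (expMass_pos d ν hp x).ne'

end ExpMass

section InverseMarton

variable {X Y : Type*} [Fintype X] [Fintype Y]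

theorem relEnt_eq_sum (q P : X → ℝ) : relEnt q P = ∑ x, q x * Real.log (q x / P x) :=
  Finset.sum_congr rfl fun x _ => by split_ifs with h <;> simp [h]

theorem relEnt_self (P : X → ℝ) : relEnt P P = 0 := by
  rw [relEnt_eq_sum]
  refine Finset.sum_eq_zero fun x _ => ?_
  by_cases hx : P x = 0 <;> simp [hx]

theorem relEnt_eq_sum_sub {q P : X → ℝ} (h : AbsCont q P) :
    relEnt q P = ∑ x, (q x * Real.log (q x) - q x * Real.log (P x)) := by
  rw [relEnt_eq_sum]
  refine Finset.sum_congr rfl fun x _ => ?_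
  by_cases hq : q x = 0
  · simp [hq]
  · rw [Real.log_div hq fun hP => hq (h x hP)]; ring

/-- The output distribution of the channel `V` with input distribution `q`. -/
def outDist (q : X → ℝ) (V : X → Y → ℝ) (y : Y) : ℝ := ∑ x, q x * V x y

theorem mutInfo_eq_sum (q : X → ℝ) (V : X → Y → ℝ) :
    mutInfo q V = ∑ x, ∑ y, q x * V x y * Real.log (V x y / outDist q V y) :=
  Finset.sum_congr rfl fun x _ => Finset.sum_congr rfl fun y _ => by
    split_ifs with h <;> simp [h, outDist]

theorem outDist_isDist {q : X → ℝ} {V : X → Y → ℝ} (hq : IsDist q) (hV : IsCondDist V) :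
    IsDist (outDist q V) := by
  refine ⟨fun y => Finset.sum_nonneg fun x _ => mul_nonneg (hq.1 x) ((hV x).1 y), ?_⟩
  simp only [outDist]
  rw [Finset.sum_comm]
  simp [← Finset.mul_sum, (hV _).2, hq.2]

theorem mul_eq_zero_of_outDist_eq_zero {q : X → ℝ} {V : X → Y → ℝ} (hq : IsDist q)
    (hV : IsCondDist V) {y : Y} (h : outDist q V y = 0) (x : X) : q x * V x y = 0 :=
  (Finset.sum_eq_zero_iff_of_nonneg fun x _ => mul_nonneg (hq.1 x) ((hV x).1 y)).1 h x
    (Finset.mem_univ x)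

/-- Mutual information is the smallest mean divergence from a fixed output distribution. -/
theorem mutInfo_le_sum_mul_log_div {q : X → ℝ} {V : X → Y → ℝ} {p : Y → ℝ} (hq : IsDist q)
    (hV : IsCondDist V) (hp : IsDist p) (h : ∀ x y, p y = 0 → V x y = 0) :
    mutInfo q V ≤ ∑ x, ∑ y, q x * V x y * Real.log (V x y / p y) := by
  have hs : ∀ y, p y = 0 → outDist q V y = 0 := fun y hy => by simp [outDist, h _ y hy]
  have key := sum_mul_log_div_nonneg (outDist_isDist hq hV) hp hs
  have : ∑ y, outDist q V y * Real.log (outDist q V y / p y)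
      = ∑ x, ∑ y, q x * V x y * Real.log (outDist q V y / p y) := by
    rw [Finset.sum_comm]
    simp only [outDist, Finset.sum_mul]
  rw [mutInfo_eq_sum, ← sub_nonneg, ← Finset.sum_sub_distrib]
  rw [this] at key
  refine key.trans_eq (Finset.sum_congr rfl fun x _ => ?_)
  rw [← Finset.sum_sub_distrib]
  refine Finset.sum_congr rfl fun y _ => ?_
  by_cases hz : q x * V x y = 0
  · simp [hz]
  have hv : V x y ≠ 0 := right_ne_zero_of_mul hz
  have hpy : p y ≠ 0 := fun h0 => hv (h x y h0)
  have hsy : outDist q V y ≠ 0 := fun h0 => hz (mul_eq_zero_of_outDist_eq_zero hq hV h0 x)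
  rw [Real.log_div hv hpy, Real.log_div hv hsy, Real.log_div hsy hpy]
  ring

/-- Any backward channel, here the one induced by `W`, bounds mutual information from below by an
expression that is linear in `V`. -/
theorem sum_mul_log_div_outDist_le_mutInfo {q : X → ℝ} {V W : X → Y → ℝ} (hq : IsDist q)
    (hV : IsCondDist V) (hW : IsCondDist W) (h : ∀ x y, W x y = 0 → V x y = 0) :
    ∑ x, ∑ y, q x * V x y * Real.log (W x y / outDist q W y) ≤ mutInfo q V := by
  have hs : ∀ y, outDist q W y = 0 → outDist q V y = 0 := fun y hy =>
    Finset.sum_eq_zero fun x _ => by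
      rcases mul_eq_zero.1 (mul_eq_zero_of_outDist_eq_zero hq hW hy x) with h0 | h0
      · simp [h0]
      · simp [h x y h0]
  rw [mutInfo_eq_sum, ← sub_nonneg, ← Finset.sum_sub_distrib]
  simp only [← Finset.sum_sub_distrib]
  rw [Finset.sum_comm]
  refine Finset.sum_nonneg fun y _ => ?_
  have hle : ∀ x, q x * V x y - q x * W x y * (outDist q V y / outDist q W y)
      ≤ q x * V x y * Real.log (V x y / outDist q V y)
        - q x * V x y * Real.log (W x y / outDist q W y) := fun x => by
    by_cases hz : q x * V x y = 0
    · rw [hz]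
      have := mul_nonneg (mul_nonneg (hq.1 x) ((hW x).1 y))
        (div_nonneg ((outDist_isDist hq hV).1 y) ((outDist_isDist hq hW).1 y))
      linarith
    have hqx : q x ≠ 0 := left_ne_zero_of_mul hz
    have hv : V x y ≠ 0 := right_ne_zero_of_mul hz
    have hw : W x y ≠ 0 := fun h0 => hv (h x y h0)
    have hsv : outDist q V y ≠ 0 := fun h0 => hz (mul_eq_zero_of_outDist_eq_zero hq hV h0 x)
    have hsw : outDist q W y ≠ 0 := fun h0 => hsv (hs y h0)
    have hb : 0 ≤ q x * W x y * (outDist q V y / outDist q W y) :=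
      mul_nonneg (mul_nonneg (hq.1 x) ((hW x).1 y))
        (div_nonneg ((outDist_isDist hq hV).1 y) ((outDist_isDist hq hW).1 y))
    have hb0 : q x * W x y * (outDist q V y / outDist q W y) ≠ 0 :=
      mul_ne_zero (mul_ne_zero hqx hw) (div_ne_zero hsv hsw)
    refine (sub_le_mul_log_div (mul_nonneg (hq.1 x) ((hV x).1 y)) hb
      fun h0 => absurd h0 hb0).trans_eq ?_
    rw [Real.log_div hz hb0, Real.log_mul hqx hv, Real.log_mul (mul_ne_zero hqx hw)
      (div_ne_zero hsv hsw), Real.log_mul hqx hw, Real.log_div hsv hsw, Real.log_div hv hsv,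
      Real.log_div hw hsw]
    ring
  refine le_trans ?_ (Finset.sum_le_sum fun x _ => hle x)
  rw [Finset.sum_sub_distrib, ← Finset.sum_mul]
  change 0 ≤ outDist q V y - outDist q W y * (outDist q V y / outDist q W y)
  by_cases h0 : outDist q W y = 0
  · simp [h0, hs y h0]
  · rw [mul_div_cancel₀ _ h0, sub_self]

theorem convexOn_mutInfo {q : X → ℝ} (hq : IsDist q) :
    ConvexOn ℝ {V : X → Y → ℝ | IsCondDist V} (mutInfo q) := by
  refine ⟨convex_setOf_isCondDist, fun V hV V' hV' a b ha hb hab => ?_⟩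
  rcases ha.eq_or_lt with rfl | ha
  · obtain rfl : b = 1 := by linarith
    simp
  rcases hb.eq_or_lt with rfl | hb
  · obtain rfl : a = 1 := by linarith
    simp
  have hW := convex_setOf_isCondDist hV hV' ha.le hb.le hab
  set W := a • V + b • V' with hWdef
  have hWxy : ∀ x y, W x y = a * V x y + b * V' x y := fun x y => by simp [hWdef]
  have h1 := sum_mul_log_div_outDist_le_mutInfo hq hV hW fun x y h0 => by
    rw [hWxy] at h0
    nlinarith [mul_nonneg hb.le ((hV' x).1 y), mul_nonneg ha.le ((hV x).1 y)]
  have h2 := sum_mul_log_div_outDist_le_mutInfo hq hV' hW fun x y h0 => by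
    rw [hWxy] at h0
    nlinarith [mul_nonneg hb.le ((hV' x).1 y), mul_nonneg ha.le ((hV x).1 y)]
  have h3 : mutInfo q W = a * ∑ x, ∑ y, q x * V x y * Real.log (W x y / outDist q W y)
      + b * ∑ x, ∑ y, q x * V' x y * Real.log (W x y / outDist q W y) := by
    rw [mutInfo_eq_sum]
    simp only [Finset.mul_sum, ← Finset.sum_add_distrib]
    refine Finset.sum_congr rfl fun x _ => Finset.sum_congr rfl fun y _ => ?_
    rw [show q x * W x y = q x * (a * V x y + b * V' x y) by rw [hWxy]]
    ring
  rw [h3, smul_eq_mul, smul_eq_mul]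
  gcongr

theorem continuousOn_mutInfo {q : X → ℝ} (hq : IsDist q) :
    ContinuousOn (mutInfo q) {V : X → Y → ℝ | IsCondDist V} := by
  have hc : Continuous fun V : X → Y → ℝ =>
      ∑ x, ∑ y, q x * (V x y * Real.log (V x y))
        - ∑ y, outDist q V y * Real.log (outDist q V y) := by
    have h1 : ∀ x y, Continuous fun V : X → Y → ℝ => V x y * Real.log (V x y) :=
      fun x y => Real.continuous_mul_log.comp (by fun_prop)
    have h2 : ∀ y, Continuous fun V : X → Y → ℝ => outDist q V y * Real.log (outDist q V y) :=
      fun y => Real.continuous_mul_log.comp (by unfold outDist; fun_prop)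
    fun_prop
  refine hc.continuousOn.congr fun V hV => ?_
  have : ∑ y, outDist q V y * Real.log (outDist q V y)
      = ∑ x, ∑ y, q x * V x y * Real.log (outDist q V y) := by
    rw [Finset.sum_comm]
    simp only [outDist, Finset.sum_mul]
  simp only [this, mutInfo_eq_sum, ← Finset.sum_sub_distrib]
  refine Finset.sum_congr rfl fun x _ => Finset.sum_congr rfl fun y _ => ?_
  by_cases hz : q x * V x y = 0
  · rw [← mul_assoc, hz]; simp
  rw [Real.log_div (right_ne_zero_of_mul hz)
    fun h0 => hz (mul_eq_zero_of_outDist_eq_zero hq hV h0 x)]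
  ring

theorem sum_mul_neg_log_expMass_le (d : X → Y → ℝ) (ν : ℝ) {q : X → ℝ} {V : X → Y → ℝ}
    {p : Y → ℝ} (hq : IsDist q) (hV : IsCondDist V) (hp : IsDist p)
    (h : ∀ x y, p y = 0 → q x * V x y = 0) :
    ∑ x, q x * -Real.log (expMass d ν p x)
      ≤ ∑ x, ∑ y, q x * V x y * Real.log (V x y / p y) + ν * ∑ x, ∑ y, q x * V x y * d x y := by
  rw [Finset.mul_sum, ← Finset.sum_add_distrib]
  refine Finset.sum_le_sum fun x _ => ?_
  by_cases hqx : q x = 0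
  · simp [hqx]
  have ha := expMass_pos d ν hp x
  have hV0 : ∀ y, p y = 0 → V x y = 0 := fun y hy => by simpa [hqx] using h x y hy
  have hb : IsDist fun y => p y * Real.exp (-ν * d x y) / expMass d ν p x := by
    refine ⟨fun y => div_nonneg (mul_nonneg (hp.1 y) (Real.exp_pos _).le) ha.le, ?_⟩
    rw [← Finset.sum_div]
    exact div_self ha.ne'
  have key := sum_mul_log_div_nonneg (hV x) hb fun y hy => hV0 y (by
    simpa [ha.ne', (Real.exp_pos _).ne'] using hy)
  have hsum : ∑ y, V x y * Real.log (V x y / (p y * Real.exp (-ν * d x y) / expMass d ν p x))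
      = ∑ y, (V x y * Real.log (V x y / p y) + ν * (V x y * d x y)
        + V x y * Real.log (expMass d ν p x)) := by
    refine Finset.sum_congr rfl fun y _ => ?_
    by_cases hv : V x y = 0
    · simp [hv]
    have hpy : p y ≠ 0 := fun h0 => hv (hV0 y h0)
    rw [Real.log_div hv (by positivity), Real.log_div (by positivity) ha.ne',
      Real.log_mul hpy (Real.exp_pos _).ne', Real.log_exp, Real.log_div hv hpy]
    ring
  rw [hsum, Finset.sum_add_distrib, Finset.sum_add_distrib, ← Finset.sum_mul, (hV x).2,
    ← Finset.mul_sum] at key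
  have := mul_le_mul_of_nonneg_left key (hq.1 x)
  simp only [mul_assoc, ← Finset.mul_sum]
  linarith

theorem exists_isCondDist_mutInfo_le (d : X → Y → ℝ) (ν : ℝ) {q : X → ℝ} {p : Y → ℝ}
    (hq : IsDist q) (hp : IsDist p) :
    ∃ V : X → Y → ℝ, IsCondDist V ∧ mutInfo q V + ν * ∑ x, ∑ y, q x * V x y * d x y
      ≤ ∑ x, q x * -Real.log (expMass d ν p x) := by
  let V : X → Y → ℝ := fun x y => p y * Real.exp (-ν * d x y) / expMass d ν p x
  have hV : IsCondDist V := fun x => by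
    refine ⟨fun y => div_nonneg (mul_nonneg (hp.1 y) (Real.exp_pos _).le)
      (expMass_pos d ν hp x).le, ?_⟩
    simp only [V]
    rw [← Finset.sum_div]
    exact div_self (expMass_pos d ν hp x).ne'
  refine ⟨V, hV, ?_⟩
  have hle := mutInfo_le_sum_mul_log_div hq hV hp fun x y hy => by simp [V, hy]
  refine (add_le_add_left hle _).trans_eq ?_
  rw [Finset.mul_sum, ← Finset.sum_add_distrib]
  refine Finset.sum_congr rfl fun x _ => ?_
  have ha := expMass_pos d ν hp x
  have hsum : ∑ y, (V x y * Real.log (V x y / p y) + ν * (V x y * d x y))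
      = ∑ y, V x y * -Real.log (expMass d ν p x) := by
    refine Finset.sum_congr rfl fun y _ => ?_
    by_cases hpy : p y = 0
    · simp [V, hpy]
    have : V x y / p y = Real.exp (-ν * d x y) / expMass d ν p x := by
      simp only [V]; field_simp
    rw [this, Real.log_div (Real.exp_pos _).ne' ha.ne', Real.log_exp]
    ring
  rw [Finset.sum_add_distrib, ← Finset.sum_mul, (hV x).2, ← Finset.mul_sum, one_mul] at hsum
  simp only [mul_assoc, ← Finset.mul_sum]
  rw [← hsum]
  ring

theorem sum_mul_exp_pos {P : X → ℝ} (hP : IsDist P) (c : X → ℝ) :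
    0 < ∑ x, P x * Real.exp (c x) := by
  obtain ⟨x, -, hx⟩ : ∃ x ∈ Finset.univ, 0 < P x :=
    Finset.exists_lt_of_sum_lt (by simp [hP.2])
  exact Finset.sum_pos' (fun x _ => mul_nonneg (hP.1 x) (Real.exp_pos _).le)
    ⟨x, Finset.mem_univ x, mul_pos hx (Real.exp_pos _)⟩

theorem isDist_tilt {P : X → ℝ} (hP : IsDist P) (c : X → ℝ) :
    IsDist fun x => P x * Real.exp (c x) / ∑ x', P x' * Real.exp (c x') := by
  have hZ := sum_mul_exp_pos hP c
  refine ⟨fun x => div_nonneg (mul_nonneg (hP.1 x) (Real.exp_pos _).le) hZ.le, ?_⟩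
  rw [← Finset.sum_div]
  exact div_self hZ.ne'

/-- The Donsker–Varadhan inequality. -/
theorem sum_mul_le_log_add_relEnt {q P : X → ℝ} (hq : IsDist q) (hP : IsDist P)
    (hqP : AbsCont q P) (c : X → ℝ) :
    ∑ x, q x * c x ≤ Real.log (∑ x, P x * Real.exp (c x)) + relEnt q P := by
  have hZ := sum_mul_exp_pos hP c
  have key := sum_mul_log_div_nonneg hq (isDist_tilt hP c) fun x hx =>
    hqP x (by simpa [hZ.ne', (Real.exp_pos _).ne'] using hx)
  have hsum : ∑ x, q x * Real.log (q x / (P x * Real.exp (c x) / ∑ x', P x' * Real.exp (c x')))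
      = ∑ x, (q x * Real.log (q x / P x) - q x * c x
        + q x * Real.log (∑ x', P x' * Real.exp (c x'))) := by
    refine Finset.sum_congr rfl fun x _ => ?_
    by_cases hqx : q x = 0
    · simp [hqx]
    have hPx : P x ≠ 0 := fun h0 => hqx (hqP x h0)
    rw [Real.log_div hqx (by positivity), Real.log_div (by positivity) hZ.ne',
      Real.log_mul hPx (Real.exp_pos _).ne', Real.log_exp, Real.log_div hqx hPx]
    ring
  rw [hsum, Finset.sum_add_distrib, Finset.sum_sub_distrib, ← Finset.sum_mul, hq.2] at key
  rw [relEnt_eq_sum]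
  linarith

/-- Exponential tilting attains equality in the Donsker–Varadhan inequality. -/
theorem exists_sum_mul_eq_log_add_relEnt {P : X → ℝ} (hP : IsDist P) (c : X → ℝ) :
    ∃ q, IsDist q ∧ AbsCont q P ∧
      ∑ x, q x * c x = Real.log (∑ x, P x * Real.exp (c x)) + relEnt q P := by
  have hZ := sum_mul_exp_pos hP c
  have hq := isDist_tilt hP c
  refine ⟨_, hq, fun x hx => by simp [hx], ?_⟩
  set Z := ∑ x, P x * Real.exp (c x)
  set q : X → ℝ := fun x => P x * Real.exp (c x) / Z with hqdef
  have hsum : relEnt q P = ∑ x, (q x * c x - q x * Real.log Z) := by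
    rw [relEnt_eq_sum]
    refine Finset.sum_congr rfl fun x _ => ?_
    by_cases hPx : P x = 0
    · simp [hqdef, hPx]
    have : q x / P x = Real.exp (c x) / Z := by simp only [hqdef]; field_simp
    rw [this, Real.log_div (Real.exp_pos _).ne' hZ.ne', Real.log_exp]
    ring
  rw [hsum, Finset.sum_sub_distrib, ← Finset.sum_mul, hq.2]
  ring

theorem mutInfo_nonneg {q : X → ℝ} {V : X → Y → ℝ} (hq : IsDist q) (hV : IsCondDist V) :
    0 ≤ mutInfo q V := by
  have := sum_mul_neg_log_expMass_le (fun _ _ => 0) 0 hq hV (outDist_isDist hq hV)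
    fun x y h => mul_eq_zero_of_outDist_eq_zero hq hV h x
  rw [← mutInfo_eq_sum] at this
  simpa [expMass, (outDist_isDist hq hV).2] using this

theorem mutInfo_le_log_card [Nonempty Y] {q : X → ℝ} {V : X → Y → ℝ} (hq : IsDist q)
    (hV : IsCondDist V) : mutInfo q V ≤ Real.log (Fintype.card Y) := by
  have hn : (0 : ℝ) < Fintype.card Y := by exact_mod_cast Fintype.card_pos
  have hp : IsDist fun _ : Y => (Fintype.card Y : ℝ)⁻¹ :=
    ⟨fun _ => by positivity, by simp [hn.ne']⟩
  refine (mutInfo_le_sum_mul_log_div hq hV hp fun x y h => absurd h (inv_ne_zero hn.ne')).trans ?_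
  have hle : ∀ x y, q x * V x y * Real.log (V x y / (Fintype.card Y : ℝ)⁻¹)
      ≤ q x * V x y * Real.log (Fintype.card Y) := fun x y => by
    rcases ((hV x).1 y).eq_or_lt with h0 | h0
    · simp [← h0]
    refine mul_le_mul_of_nonneg_left (Real.log_le_log (by positivity) ?_)
      (mul_nonneg (hq.1 x) h0.le)
    rw [div_inv_eq_mul]
    refine mul_le_of_le_one_left hn.le ?_
    rw [← (hV x).2]
    exact Finset.single_le_sum (fun y _ => (hV x).1 y) (Finset.mem_univ y)
  refine (Finset.sum_le_sum fun x _ => Finset.sum_le_sum fun y _ => hle x y).trans_eq ?_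
  simp [← Finset.sum_mul, ← Finset.mul_sum, (hV _).2, hq.2]

theorem bddBelow_rateDist {d : X → Y → ℝ} {Δ : ℝ} {q : X → ℝ} (hq : IsDist q) :
    BddBelow { r | ∃ V : X → Y → ℝ, IsCondDist V ∧
      (∑ x, ∑ y, q x * V x y * d x y) ≤ Δ ∧ r = mutInfo q V } :=
  ⟨0, by rintro _ ⟨V, hV, -, rfl⟩; exact mutInfo_nonneg hq hV⟩

/-- A channel that reproduces every letter at distortion zero. -/
theorem exists_isCondDist_distortion_eq_zero [Nonempty Y] {d : X → Y → ℝ}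
    (hd : ∀ x y, 0 ≤ d x y) (hd0 : (⨆ x, ⨅ y, d x y) = 0) :
    ∃ V : X → Y → ℝ, IsCondDist V ∧ ∀ q : X → ℝ, ∑ x, ∑ y, q x * V x y * d x y = 0 := by
  classical
  have hex : ∀ x, ∃ y, d x y = 0 := fun x => by
    obtain ⟨y, hy⟩ := exists_eq_ciInf_of_finite (f := d x)
    refine ⟨y, le_antisymm ?_ (hd x y)⟩
    rw [hy, ← hd0]
    exact le_ciSup (f := fun x => ⨅ y, d x y) (Set.finite_range _).bddAbove x
  choose g hg using hex
  refine ⟨fun x => Pi.single (g x) 1, fun x => ⟨fun y => ?_, by simp⟩, fun q => ?_⟩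
  · by_cases h : y = g x
    · subst h; simp
    · simp [h]
  · refine Finset.sum_eq_zero fun x _ => Finset.sum_eq_zero fun y _ => ?_
    by_cases h : y = g x
    · subst h; simp [hg]
    · simp [h]

/-- Lagrangian duality for the rate-distortion function. -/
theorem exists_multiplier_of_lt_rateDist [Nonempty Y] (d : X → Y → ℝ) {Δ t : ℝ} {q : X → ℝ}
    (hq : IsDist q) (ht : t < rateDist d Δ q) :
    ∃ ν : ℝ, 0 ≤ ν ∧ ∀ V : X → Y → ℝ, IsCondDist V →
      t < mutInfo q V + ν * (∑ x, ∑ y, q x * V x y * d x y - Δ) := by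
  classical
  obtain ⟨y₀⟩ := ‹Nonempty Y›
  refine exists_forall_lt_of_forall_exists_lt (A := {V : X → Y → ℝ | IsCondDist V})
    (B := Set.Ici 0)
    (f := fun V ν => mutInfo q V + ν * (∑ x, ∑ y, q x * V x y * d x y - Δ))
    ⟨fun _ => Pi.single y₀ 1, fun _ => single_mem_stdSimplex ℝ y₀⟩ convex_setOf_isCondDist
    isCompact_setOf_isCondDist (convex_Ici 0) (fun ν _ => ?_) (fun ν _ => ?_) (fun V _ => ?_)
    (fun V _ => ?_) fun V hV => ?_
  · exact (continuousOn_mutInfo hq).add (Continuous.continuousOn (by fun_prop))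
  · refine (convexOn_mutInfo hq).add ⟨convex_setOf_isCondDist, fun V _ V' _ a b _ _ hab => ?_⟩
    obtain rfl : b = 1 - a := by linarith
    refine le_of_eq ?_
    have : ∑ x, ∑ y, q x * (a • V + (1 - a) • V') x y * d x y
        = a * ∑ x, ∑ y, q x * V x y * d x y + (1 - a) * ∑ x, ∑ y, q x * V' x y * d x y := by
      simp only [Finset.mul_sum, ← Finset.sum_add_distrib, Pi.add_apply, Pi.smul_apply,
        smul_eq_mul]
      exact Finset.sum_congr rfl fun x _ => Finset.sum_congr rfl fun y _ => by ring
    simp only [this, smul_eq_mul]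
    ring
  · fun_prop
  · refine ⟨convex_Ici 0, fun ν _ ν' _ a b _ _ hab => le_of_eq ?_⟩
    obtain rfl : b = 1 - a := by linarith
    simp only [smul_eq_mul]
    ring
  · by_cases hD : ∑ x, ∑ y, q x * V x y * d x y ≤ Δ
    · refine ⟨0, Set.self_mem_Ici, ?_⟩
      simpa using ht.trans_le (csInf_le (bddBelow_rateDist hq) ⟨V, hV, hD, rfl⟩)
    · have hpos : 0 < ∑ x, ∑ y, q x * V x y * d x y - Δ := by linarith
      refine ⟨|t + 1| / (∑ x, ∑ y, q x * V x y * d x y - Δ), div_nonneg (abs_nonneg _) hpos.le, ?_⟩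
      rw [div_mul_cancel₀ _ hpos.ne']
      linarith [mutInfo_nonneg hq hV, le_abs_self (t + 1)]

theorem convex_setOf_isDist_absCont (P : X → ℝ) :
    Convex ℝ {q : X → ℝ | IsDist q ∧ AbsCont q P} := by
  intro q hq q' hq' a b ha hb hab
  exact ⟨convex_stdSimplex ℝ X hq.1 hq'.1 ha hb hab, fun x hx => by
    simp [hq.2 x hx, hq'.2 x hx]⟩

theorem isCompact_setOf_isDist_absCont (P : X → ℝ) :
    IsCompact {q : X → ℝ | IsDist q ∧ AbsCont q P} := by
  refine (isCompact_stdSimplex ℝ X).inter_right ?_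
  change IsClosed {q : X → ℝ | ∀ x, P x = 0 → q x = 0}
  simp only [Set.ofPred_forall]
  exact isClosed_iInter fun x => isClosed_iInter fun _ =>
    isClosed_eq (continuous_apply x) continuous_const

theorem continuousOn_relEnt (P : X → ℝ) :
    ContinuousOn (fun q => relEnt q P) {q : X → ℝ | IsDist q ∧ AbsCont q P} := by
  have h1 : ∀ x, Continuous fun q : X → ℝ => q x * Real.log (q x) :=
    fun x => Real.continuous_mul_log.comp (continuous_apply x)
  have hc : Continuous fun q : X → ℝ => ∑ x, (q x * Real.log (q x) - q x * Real.log (P x)) := by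
    fun_prop
  exact hc.continuousOn.congr fun q hq => relEnt_eq_sum_sub hq.2

theorem convexOn_relEnt (P : X → ℝ) :
    ConvexOn ℝ {q : X → ℝ | IsDist q ∧ AbsCont q P} fun q => relEnt q P := by
  have hcv := convex_setOf_isDist_absCont P
  refine ⟨hcv, fun q hq q' hq' a b ha hb hab => ?_⟩
  beta_reduce
  rw [relEnt_eq_sum_sub (hcv hq hq' ha hb hab).2, relEnt_eq_sum_sub hq.2, relEnt_eq_sum_sub hq'.2,
    smul_eq_mul, smul_eq_mul, Finset.mul_sum, Finset.mul_sum, ← Finset.sum_add_distrib]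
  refine Finset.sum_le_sum fun x _ => ?_
  have := Real.convexOn_mul_log.2 (hq.1.1 x) (hq'.1.1 x) ha hb hab
  simp only [smul_eq_mul, Pi.add_apply, Pi.smul_apply] at this ⊢
  linarith

/-- Minimax exchange over sources and pairs of a multiplier and an output distribution. -/
theorem exists_dual_of_forall_exists_lt {P : X → ℝ} (hP : IsDist P) (d : X → Y → ℝ) (ν : ℝ)
    {E t : ℝ} (hpY : ∃ p : Y → ℝ, IsDist p)
    (h : ∀ q : X → ℝ, IsDist q → AbsCont q P → relEnt q P ≤ E →
      ∃ p : Y → ℝ, IsDist p ∧ ∑ x, q x * -Real.log (expMass d ν p x) < t) :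
    ∃ μ : ℝ, 0 < μ ∧ ∃ p : Y → ℝ, IsDist p ∧ ∀ q : X → ℝ, IsDist q → AbsCont q P →
      ∑ x, q x * -Real.log (expMass d ν p x) + μ * (E - relEnt q P) < t := by
  have key := exists_forall_lt_of_forall_exists_lt (A := {q : X → ℝ | IsDist q ∧ AbsCont q P})
    (B := Set.Ioi (0 : ℝ) ×ˢ {p : Y → ℝ | IsDist p})
    (f := fun q z => ∑ x, q x * Real.log (expMass d ν z.2 x) + z.1 * (relEnt q P - E))
    (t := -t) ⟨P, hP, fun _ => id⟩ (convex_setOf_isDist_absCont P)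
    (isCompact_setOf_isDist_absCont P) ((convex_Ioi 0).prod (convex_stdSimplex ℝ Y))
    (fun z _ => ?_) (fun z hz => ?_) (fun q _ => ?_) (fun q hq => ?_) fun q hq => ?_
  · obtain ⟨⟨μ, p⟩, ⟨hμ, hp⟩, hall⟩ := key
    refine ⟨μ, hμ, p, hp, fun q hq hqP => ?_⟩
    have := hall q ⟨hq, hqP⟩
    simp only [mul_neg, Finset.sum_neg_distrib] at this ⊢
    linarith
  · exact (Continuous.continuousOn (by fun_prop)).add
      (continuousOn_const.mul ((continuousOn_relEnt P).sub continuousOn_const))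
  · refine ConvexOn.add ⟨convex_setOf_isDist_absCont P, fun q _ q' _ a b _ _ _ => le_of_eq ?_⟩
      (((convexOn_relEnt P).sub (concaveOn_const E (convex_setOf_isDist_absCont P))).smul (le_of_lt hz.1))
    simp only [smul_eq_mul, Finset.mul_sum, ← Finset.sum_add_distrib, Pi.add_apply, Pi.smul_apply]
    exact Finset.sum_congr rfl fun x _ => by ring
  · refine ContinuousOn.add (continuousOn_finsetSum _ fun x _ => continuousOn_const.mul ?_)
      (Continuous.continuousOn (by fun_prop))
    exact (continuousOn_log_expMass d ν x).comp continuousOn_snd fun z hz => hz.2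
  · refine ⟨(convex_Ioi 0).prod (convex_stdSimplex ℝ Y), fun z hz z' hz' a b ha hb hab => ?_⟩
    have hle : ∀ x, a * (q x * Real.log (expMass d ν z.2 x))
        + b * (q x * Real.log (expMass d ν z'.2 x))
        ≤ q x * Real.log (expMass d ν (a • z + b • z').2 x) := fun x => by
      have := mul_le_mul_of_nonneg_left
        ((concaveOn_log_expMass d ν x).2 hz.2 hz'.2 ha hb hab) (hq.1.1 x)
      simp only [smul_eq_mul] at this
      refine le_trans (le_of_eq ?_) this
      ring
    have := Finset.sum_le_sum fun x (_ : x ∈ Finset.univ) => hle x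
    rw [Finset.sum_add_distrib, ← Finset.mul_sum, ← Finset.mul_sum] at this
    simp only [smul_eq_mul, Prod.fst_add, Prod.smul_fst]
    linarith
  · by_cases hD : relEnt q P ≤ E
    · obtain ⟨p, hp, hlt⟩ := h q hq.1 hq.2 hD
      simp only [mul_neg, Finset.sum_neg_distrib] at hlt
      set s := ∑ x, q x * Real.log (expMass d ν p x)
      have hE : 0 < E - relEnt q P + 1 := by linarith
      refine ⟨((t + s) / (E - relEnt q P + 1), p), ⟨div_pos (by linarith) hE, hp⟩, ?_⟩
      change -t < s + (t + s) / (E - relEnt q P + 1) * (relEnt q P - E)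
      have : (t + s) / (E - relEnt q P + 1) * (relEnt q P - E)
          = (t + s) / (E - relEnt q P + 1) - (t + s) := by
        field_simp
        ring
      have hpos : 0 < (t + s) / (E - relEnt q P + 1) := div_pos (by linarith) hE
      linarith
    · obtain ⟨p, hp⟩ := hpY
      set s := ∑ x, q x * Real.log (expMass d ν p x) with hs
      have hE : 0 < relEnt q P - E := by linarith
      refine ⟨((|t + s| + 1) / (relEnt q P - E), p), ⟨div_pos (by positivity) hE, hp⟩, ?_⟩
      change -t < s + (|t + s| + 1) / (relEnt q P - E) * (relEnt q P - E)
      rw [div_mul_cancel₀ _ hE.ne']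
      linarith [neg_abs_le (t + s)]

/-- The function `G^{(μ,ν)}(p|P)`. -/
noncomputable def martonG (P : X → ℝ) (d : X → Y → ℝ) (μ ν : ℝ) (p : Y → ℝ) : ℝ :=
  if 0 < μ then
    μ * Real.log (∑ x, P x * (∑ y, p y * Real.exp (-ν * d x y)) ^ (-1 / μ))
  else
    -Real.log (⨅ x, ∑ y, p y * Real.exp (-ν * d x y))

theorem martonG_of_pos (P : X → ℝ) (d : X → Y → ℝ) {μ : ℝ} (hμ : 0 < μ) (ν : ℝ) {p : Y → ℝ}
    (hp : IsDist p) : martonG P d μ ν p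
      = μ * Real.log (∑ x, P x * Real.exp (-Real.log (expMass d ν p x) / μ)) := by
  rw [martonG, if_pos hμ]
  congr 2
  refine Finset.sum_congr rfl fun x _ => ?_
  change P x * expMass d ν p x ^ (-1 / μ) = _
  rw [Real.rpow_def_of_pos (expMass_pos d ν hp x)]
  congr 2
  ring

theorem sum_mul_neg_log_expMass_le_martonG [Nonempty X] {P q : X → ℝ} (hP : IsDist P)
    (hq : IsDist q) (hqP : AbsCont q P) (d : X → Y → ℝ) {μ : ℝ} (hμ : 0 ≤ μ) (ν : ℝ)
    {p : Y → ℝ} (hp : IsDist p) :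
    ∑ x, q x * -Real.log (expMass d ν p x) ≤ martonG P d μ ν p + μ * relEnt q P := by
  rcases hμ.eq_or_lt with rfl | hμ
  · rw [martonG, if_neg (lt_irrefl _), zero_mul, add_zero]
    change _ ≤ -Real.log (⨅ x, expMass d ν p x)
    obtain ⟨x₀, hx₀⟩ := exists_eq_ciInf_of_finite (f := expMass d ν p)
    rw [← hx₀, ← one_mul (-Real.log _), ← hq.2, Finset.sum_mul]
    refine Finset.sum_le_sum fun x _ => mul_le_mul_of_nonneg_left (neg_le_neg ?_) (hq.1 x)
    refine Real.log_le_log (expMass_pos d ν hp x₀) ?_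
    rw [hx₀]
    exact ciInf_le (Set.finite_range _).bddBelow x
  · have := mul_le_mul_of_nonneg_left (sum_mul_le_log_add_relEnt hq hP hqP
      fun x => -Real.log (expMass d ν p x) / μ) hμ.le
    rw [martonG_of_pos P d hμ ν hp, ← mul_add]
    refine le_trans (le_of_eq ?_) this
    rw [Finset.mul_sum]
    exact Finset.sum_congr rfl fun x _ => by field_simp

theorem martonG_nonneg [Nonempty X] {P : X → ℝ} (hP : IsDist P) {d : X → Y → ℝ}
    (hd : ∀ x y, 0 ≤ d x y) {μ ν : ℝ} (hμ : 0 ≤ μ) (hν : 0 ≤ ν) {p : Y → ℝ} (hp : IsDist p) :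
    0 ≤ martonG P d μ ν p := by
  have h := sum_mul_neg_log_expMass_le_martonG hP hP (fun _ => id) d hμ ν hp
  have h1 : 0 ≤ ∑ x, P x * -Real.log (expMass d ν p x) :=
    Finset.sum_nonneg fun x _ => mul_nonneg (hP.1 x) (neg_nonneg.2
      (Real.log_nonpos (expMass_pos d ν hp x).le (expMass_le_one hd hν hp x)))
  simpa [relEnt_self] using h1.trans h

/-- The dual objective, a function of the slope `ν` alone. -/
noncomputable def martonDual (P : X → ℝ) (d : X → Y → ℝ) (E Δ ν : ℝ) : ℝ :=
  sInf { w | ∃ μ : ℝ, 0 ≤ μ ∧ w = -ν * Δ + μ * E +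
    sInf { g | ∃ p : Y → ℝ, IsDist p ∧ g = martonG P d μ ν p } }

theorem bddBelow_martonG [Nonempty X] {P : X → ℝ} (hP : IsDist P) {d : X → Y → ℝ}
    (hd : ∀ x y, 0 ≤ d x y) {μ ν : ℝ} (hμ : 0 ≤ μ) (hν : 0 ≤ ν) :
    BddBelow { g | ∃ p : Y → ℝ, IsDist p ∧ g = martonG P d μ ν p } :=
  ⟨0, by rintro _ ⟨p, hp, rfl⟩; exact martonG_nonneg hP hd hμ hν hp⟩

theorem martonDual_le [Nonempty X] {P : X → ℝ} (hP : IsDist P) {d : X → Y → ℝ}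
    (hd : ∀ x y, 0 ≤ d x y) {E : ℝ} (hE : 0 ≤ E) (Δ : ℝ) {μ ν : ℝ} (hμ : 0 ≤ μ) (hν : 0 ≤ ν)
    {p : Y → ℝ} (hp : IsDist p) :
    martonDual P d E Δ ν ≤ -ν * Δ + μ * E + martonG P d μ ν p := by
  have hle : sInf { g | ∃ p : Y → ℝ, IsDist p ∧ g = martonG P d μ ν p } ≤ martonG P d μ ν p :=
    csInf_le (bddBelow_martonG hP hd hμ hν) ⟨p, hp, rfl⟩
  refine le_trans (csInf_le ⟨-ν * Δ, ?_⟩ ⟨μ, hμ, rfl⟩) (add_le_add_right hle _)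
  rintro _ ⟨μ, hμ, rfl⟩
  have : 0 ≤ sInf { g | ∃ p : Y → ℝ, IsDist p ∧ g = martonG P d μ ν p } :=
    Real.sInf_nonneg (by rintro _ ⟨p, hp, rfl⟩; exact martonG_nonneg hP hd hμ hν hp)
  linarith [mul_nonneg hμ hE]

theorem le_martonDual {P : X → ℝ} {d : X → Y → ℝ} {E Δ ν t : ℝ}
    (hpY : ∃ p : Y → ℝ, IsDist p)
    (h : ∀ μ, 0 ≤ μ → ∀ p : Y → ℝ, IsDist p → t ≤ -ν * Δ + μ * E + martonG P d μ ν p) :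
    t ≤ martonDual P d E Δ ν := by
  refine le_csInf ⟨_, 0, le_rfl, rfl⟩ ?_
  rintro _ ⟨μ, hμ, rfl⟩
  obtain ⟨p, hp⟩ := hpY
  rw [← sub_le_iff_le_add']
  refine le_csInf ⟨_, p, hp, rfl⟩ ?_
  rintro _ ⟨p, hp, rfl⟩
  linarith [h μ hμ p hp]

/-- Some source in the divergence ball is at least as hard as the dual objective. -/
theorem exists_martonDual_le_rateDist [Nonempty X] [Nonempty Y] {P : X → ℝ} (hP : IsDist P)
    {d : X → Y → ℝ} (hd : ∀ x y, 0 ≤ d x y) (hd0 : (⨆ x, ⨅ y, d x y) = 0) {E Δ : ℝ}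
    (hE : 0 ≤ E) (hΔ : 0 ≤ Δ) {ν : ℝ} (hν : 0 ≤ ν) :
    ∃ q : X → ℝ, IsDist q ∧ AbsCont q P ∧ relEnt q P ≤ E ∧
      martonDual P d E Δ ν ≤ rateDist d Δ q := by
  obtain ⟨V₀, hV₀, hdist⟩ := exists_isCondDist_distortion_eq_zero hd hd0
  have hex : ∃ q : X → ℝ, IsDist q ∧ AbsCont q P ∧ relEnt q P ≤ E ∧ ∀ p : Y → ℝ, IsDist p →
      martonDual P d E Δ ν + ν * Δ ≤ ∑ x, q x * -Real.log (expMass d ν p x) := by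
    by_contra! hcon
    obtain ⟨μ, hμ, p, hp, hall⟩ := exists_dual_of_forall_exists_lt hP d ν
      ⟨_, outDist_isDist hP hV₀⟩ hcon
    obtain ⟨q, hq, hqP, heq⟩ := exists_sum_mul_eq_log_add_relEnt hP
      fun x => -Real.log (expMass d ν p x) / μ
    have h1 := hall q hq hqP
    have h2 := martonDual_le hP hd hE Δ hμ.le hν hp
    have h3 : ∑ x, q x * -Real.log (expMass d ν p x)
        = μ * ∑ x, q x * (-Real.log (expMass d ν p x) / μ) := by
      rw [Finset.mul_sum]
      exact Finset.sum_congr rfl fun x _ => by field_simp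
    rw [martonG_of_pos P d hμ ν hp] at h2
    rw [h3, heq] at h1
    linarith
  obtain ⟨q, hq, hqP, hqE, hle⟩ := hex
  refine ⟨q, hq, hqP, hqE, le_csInf ⟨_, V₀, hV₀, (hdist q).trans_le hΔ, rfl⟩ ?_⟩
  rintro _ ⟨V, hV, hVΔ, rfl⟩
  have h1 := hle _ (outDist_isDist hq hV)
  have h2 := sum_mul_neg_log_expMass_le d ν hq hV (outDist_isDist hq hV)
    fun x y h => mul_eq_zero_of_outDist_eq_zero hq hV h x
  rw [← mutInfo_eq_sum] at h2
  linarith [mul_le_mul_of_nonneg_left hVΔ hν]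

theorem rateDist_le_log_card [Nonempty Y] {d : X → Y → ℝ} (hd : ∀ x y, 0 ≤ d x y)
    (hd0 : (⨆ x, ⨅ y, d x y) = 0) {Δ : ℝ} (hΔ : 0 ≤ Δ) {q : X → ℝ} (hq : IsDist q) :
    rateDist d Δ q ≤ Real.log (Fintype.card Y) := by
  obtain ⟨V₀, hV₀, hdist⟩ := exists_isCondDist_distortion_eq_zero hd hd0
  exact (csInf_le (bddBelow_rateDist hq) ⟨V₀, hV₀, (hdist q).trans_le hΔ, rfl⟩).trans
    (mutInfo_le_log_card hq hV₀)

theorem exists_le_martonDual_of_lt_rateDist [Nonempty X] [Nonempty Y] {P q : X → ℝ}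
    (hP : IsDist P) (hq : IsDist q) (hqP : AbsCont q P) {d : X → Y → ℝ} {E Δ t : ℝ}
    (hqE : relEnt q P ≤ E) (ht : t < rateDist d Δ q) :
    ∃ ν : ℝ, 0 ≤ ν ∧ t ≤ martonDual P d E Δ ν := by
  classical
  obtain ⟨ν, hν, hall⟩ := exists_multiplier_of_lt_rateDist d hq ht
  obtain ⟨y₀⟩ := ‹Nonempty Y›
  refine ⟨ν, hν, le_martonDual ⟨Pi.single y₀ 1, single_mem_stdSimplex ℝ y₀⟩ fun μ hμ p hp => ?_⟩
  obtain ⟨V, hV, hle⟩ := exists_isCondDist_mutInfo_le d ν hq hp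
  have h1 := hall V hV
  have h2 := sum_mul_neg_log_expMass_le_martonG hP hq hqP d hμ ν hp
  linarith [mul_le_mul_of_nonneg_left hqE hμ]

end InverseMarton

/-- Theorem 1: parametric expression for the inverse Marton exponent. -/
theorem inverse_marton_parametric
    {X Y : Type*} [Fintype X] [Fintype Y] [Nonempty X] [Nonempty Y]
    (P : X → ℝ) (hP : IsDist P)
    (d : X → Y → ℝ) (hd : ∀ x y, 0 ≤ d x y)
    (hd0 : (⨆ x, ⨅ y, d x y) = 0)
    (E : ℝ) (hE : 0 ≤ E)
    (Δ : ℝ) (hΔ0 : 0 ≤ Δ) (hΔ1 : Δ ≤ ⨅ y, ∑ x, P x * d x y) :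
    sSup { r | ∃ q : X → ℝ, IsDist q ∧ AbsCont q P ∧ relEnt q P ≤ E ∧
        r = rateDist d Δ q }
      = sSup { v | ∃ ν : ℝ, 0 ≤ ν ∧ v = sInf { w | ∃ μ : ℝ, 0 ≤ μ ∧ w =
          -ν * Δ + μ * E + sInf { g | ∃ pY : Y → ℝ, IsDist pY ∧
            g = if 0 < μ then
                  μ * Real.log (∑ x, P x *
                    (∑ y, pY y * Real.exp (-ν * d x y)) ^ (-1 / μ))
                else
                  -Real.log (⨅ x, ∑ y, pY y * Real.exp (-ν * d x y)) } } } := by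

  change _ = sSup { v | ∃ ν : ℝ, 0 ≤ ν ∧ v = martonDual P d E Δ ν }
  apply le_antisymm
  · refine csSup_le ⟨_, P, hP, fun _ => id, (relEnt_self P).trans_le hE, rfl⟩ ?_
    rintro _ ⟨q, hq, hqP, hqE, rfl⟩
    refine le_of_forall_lt fun t ht => ?_
    obtain ⟨t', htt', ht'⟩ := exists_between ht
    obtain ⟨ν, hν, hle⟩ := exists_le_martonDual_of_lt_rateDist hP hq hqP hqE ht'
    refine htt'.trans_le (hle.trans (le_csSup ⟨Real.log (Fintype.card Y), ?_⟩ ⟨ν, hν, rfl⟩))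
    rintro _ ⟨ν, hν, rfl⟩
    obtain ⟨q, hq, -, -, hle⟩ := exists_martonDual_le_rateDist hP hd hd0 hE hΔ0 hν
    exact hle.trans (rateDist_le_log_card hd hd0 hΔ0 hq)
  · refine csSup_le ⟨_, 0, le_rfl, rfl⟩ ?_
    rintro _ ⟨ν, hν, rfl⟩
    obtain ⟨q, hq, hqP, hqE, hle⟩ := exists_martonDual_le_rateDist hP hd hd0 hE hΔ0 hν
    refine hle.trans (le_csSup ⟨Real.log (Fintype.card Y), ?_⟩ ⟨q, hq, hqP, hqE, rfl⟩)
    rintro _ ⟨q, hq, -, -, rfl⟩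
    exact rateDist_le_log_card hd hd0 hΔ0 hq
end

section
/- For every μ ≥ 0, ν ≥ 0, probability distribution p_Y on 𝒴, and probability distribution P on 𝒳, the function G^{(μ,ν)}(p_Y|P) := max_{q ∈ 𝒫(𝒳)} [ −μ D(q‖P) − ∑_x q(x) log ∑_y p_Y(y) e^{−ν d(x,y)} ] is given explicitly by G^{(μ,ν)}(p_Y|P) = μ log ∑_x P(x) (∑_y p_Y(y) e^{−ν d(x,y)})^{−1/μ} if μ > 0, and G^{(0,ν)}(p_Y|P) = −log min_x ∑_y p_Y(y) e^{−ν d(x,y)}. -/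
open scoped BigOperators

theorem relEnt_nonneg {X : Type*} [Fintype X] {q Q : X → ℝ} (hq : IsDist q) (hQ : IsDist Q)
    (hac : AbsCont q Q) : 0 ≤ relEnt q Q := by
  have key : ∑ x, (q x - Q x) ≤ relEnt q Q := by
    refine Finset.sum_le_sum fun x _ => ?_
    split_ifs with h
    · linarith [hQ.1 x]
    · have hqx : 0 < q x := lt_of_le_of_ne (hq.1 x) (Ne.symm h)
      have hQx : 0 < Q x := lt_of_le_of_ne (hQ.1 x) fun h0 => h (hac x h0.symm)
      have hlog := Real.one_sub_inv_le_log_of_pos (div_pos hqx hQx)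
      rw [inv_div] at hlog
      have hmul := mul_le_mul_of_nonneg_left hlog hqx.le
      rwa [mul_sub, mul_one, mul_div_cancel₀ _ h] at hmul
  rwa [Finset.sum_sub_distrib, hq.2, hQ.2, sub_self] at key

theorem relEnt_self_s6 {X : Type*} [Fintype X] (q : X → ℝ) : relEnt q q = 0 := by
  refine Finset.sum_eq_zero fun x _ => ?_
  split_ifs with h
  · rfl
  · rw [div_self h, Real.log_one, mul_zero]

/-- The distribution `P` tilted by `W ^ (-1 / μ)`. -/
noncomputable def tiltedDist {X : Type*} [Fintype X] (P W : X → ℝ) (μ : ℝ) (x : X) : ℝ :=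
  P x * W x ^ (-1 / μ) / ∑ x', P x' * W x' ^ (-1 / μ)

theorem sum_mul_rpow_pos {X : Type*} [Fintype X] {P W : X → ℝ} (hP : IsDist P)
    (hW : ∀ x, 0 < W x) (r : ℝ) : 0 < ∑ x, P x * W x ^ r := by
  obtain ⟨x, -, hx⟩ := Finset.exists_ne_zero_of_sum_ne_zero (hP.2.trans_ne one_ne_zero)
  refine Finset.sum_pos' (fun x _ => mul_nonneg (hP.1 x) (Real.rpow_pos_of_pos (hW x) r).le)
    ⟨x, Finset.mem_univ x, mul_pos (lt_of_le_of_ne (hP.1 x) (Ne.symm hx))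
      (Real.rpow_pos_of_pos (hW x) r)⟩

theorem isDist_tiltedDist {X : Type*} [Fintype X] {P W : X → ℝ} (hP : IsDist P)
    (hW : ∀ x, 0 < W x) (μ : ℝ) : IsDist (tiltedDist P W μ) := by
  have hS := sum_mul_rpow_pos hP hW (-1 / μ)
  refine ⟨fun x => div_nonneg (mul_nonneg (hP.1 x) (Real.rpow_pos_of_pos (hW x) _).le) hS.le, ?_⟩
  simp only [tiltedDist]
  rw [← Finset.sum_div, div_self hS.ne']

theorem tiltedDist_eq_zero_iff {X : Type*} [Fintype X] {P W : X → ℝ} (hP : IsDist P)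
    (hW : ∀ x, 0 < W x) (μ : ℝ) (x : X) : tiltedDist P W μ x = 0 ↔ P x = 0 := by
  simp [tiltedDist, (sum_mul_rpow_pos hP hW (-1 / μ)).ne', (Real.rpow_pos_of_pos (hW x) _).ne']

theorem neg_mul_relEnt_sub_sum_mul_log {X : Type*} [Fintype X] {P W q : X → ℝ} (hP : IsDist P)
    (hW : ∀ x, 0 < W x) {μ : ℝ} (hμ : 0 < μ) (hq : IsDist q) (hac : AbsCont q P) :
    -μ * relEnt q P - ∑ x, q x * Real.log (W x) =
      μ * Real.log (∑ x, P x * W x ^ (-1 / μ)) - μ * relEnt q (tiltedDist P W μ) := by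
  have hS := sum_mul_rpow_pos hP hW (-1 / μ)
  have hterm : relEnt q (tiltedDist P W μ) = ∑ x, ((if q x = 0 then 0 else
      q x * Real.log (q x / P x)) + q x * Real.log (W x) / μ
        + q x * Real.log (∑ x', P x' * W x' ^ (-1 / μ))) := by
    refine Finset.sum_congr rfl fun x _ => ?_
    split_ifs with h
    · simp [h]
    · have hPx : P x ≠ 0 := fun h0 => h (hac x h0)
      have hr := (Real.rpow_pos_of_pos (hW x) (-1 / μ)).ne'
      rw [tiltedDist, Real.log_div h (div_ne_zero (mul_ne_zero hPx hr) hS.ne'),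
        Real.log_div (mul_ne_zero hPx hr) hS.ne', Real.log_mul hPx hr, Real.log_rpow (hW x),
        Real.log_div h hPx]
      ring
  rw [hterm, Finset.sum_add_distrib, Finset.sum_add_distrib, ← Finset.sum_div, ← Finset.sum_mul,
    hq.2, relEnt]
  field_simp
  ring

theorem isGreatest_of_pos {X : Type*} [Fintype X] {P W : X → ℝ} (hP : IsDist P)
    (hW : ∀ x, 0 < W x) {μ : ℝ} (hμ : 0 < μ) :
    IsGreatest { v | ∃ q : X → ℝ, IsDist q ∧ (0 < μ → AbsCont q P) ∧
        v = -μ * relEnt q P - ∑ x, q x * Real.log (W x) }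
      (μ * Real.log (∑ x, P x * W x ^ (-1 / μ))) := by
  have hT := isDist_tiltedDist hP hW μ
  constructor
  · have hac : AbsCont (tiltedDist P W μ) P := fun x =>
      (tiltedDist_eq_zero_iff hP hW μ x).2
    refine ⟨_, hT, fun _ => hac, ?_⟩
    rw [neg_mul_relEnt_sub_sum_mul_log hP hW hμ hT hac, relEnt_self_s6, mul_zero, sub_zero]
  · rintro _ ⟨q, hq, hac, rfl⟩
    rw [neg_mul_relEnt_sub_sum_mul_log hP hW hμ hq (hac hμ)]
    have hD := relEnt_nonneg hq hT fun x hx => hac hμ x ((tiltedDist_eq_zero_iff hP hW μ x).1 hx)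
    exact sub_le_self _ (mul_nonneg hμ.le hD)

theorem isGreatest_of_eq_zero {X : Type*} [Fintype X] [Nonempty X] (P : X → ℝ) {W : X → ℝ}
    (hW : ∀ x, 0 < W x) :
    IsGreatest { v | ∃ q : X → ℝ, IsDist q ∧ ((0 : ℝ) < 0 → AbsCont q P) ∧
        v = -0 * relEnt q P - ∑ x, q x * Real.log (W x) } (-Real.log (⨅ x, W x)) := by
  classical
  obtain ⟨x₀, hx₀⟩ := exists_eq_ciInf_of_finite (f := W)
  rw [← hx₀]
  constructor
  · refine ⟨Pi.single x₀ 1, ⟨fun x => ?_, by simp⟩, fun h => absurd h (lt_irrefl _), ?_⟩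
    · rw [Pi.single_apply]
      split_ifs <;> norm_num
    · simp [Pi.single_apply]
  · rintro _ ⟨q, hq, -, rfl⟩
    have hle : ∑ x, q x * Real.log (W x₀) ≤ ∑ x, q x * Real.log (W x) :=
      Finset.sum_le_sum fun x _ => mul_le_mul_of_nonneg_left
        (Real.log_le_log (hW x₀) (hx₀ ▸ ciInf_le (Set.finite_range W).bddBelow x)) (hq.1 x)
    rw [← Finset.sum_mul, hq.2, one_mul] at hle
    linarith

/-- Lemma 5: explicit formula for `G^{(μ,ν)}(p_Y|P)`. -/
theorem G_mu_nu_explicit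
    {X Y : Type*} [Fintype X] [Fintype Y] [Nonempty X] [Nonempty Y]
    (P : X → ℝ) (hP : IsDist P)
    (d : X → Y → ℝ) (hd : ∀ x y, 0 ≤ d x y)
    (μ ν : ℝ) (hμ : 0 ≤ μ) (hν : 0 ≤ ν)
    (pY : Y → ℝ) (hpY : IsDist pY) :
    sSup { v | ∃ q : X → ℝ, IsDist q ∧ (0 < μ → AbsCont q P) ∧
        v = -μ * relEnt q P
            - ∑ x, q x * Real.log (∑ y, pY y * Real.exp (-ν * d x y)) }
      = if 0 < μ then
          μ * Real.log (∑ x, P x * (∑ y, pY y * Real.exp (-ν * d x y)) ^ (-1 / μ))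
        else
          -Real.log (⨅ x, ∑ y, pY y * Real.exp (-ν * d x y)) := by
  have hW : ∀ x, 0 < ∑ y, pY y * Real.exp (-ν * d x y) := fun x => by
    simpa only [Real.rpow_one] using
      sum_mul_rpow_pos (W := fun y => Real.exp (-ν * d x y)) hpY (fun _ => Real.exp_pos _) 1
  split_ifs with h
  · exact (isGreatest_of_pos hP hW h).csSup_eq
  · obtain rfl : μ = 0 := le_antisymm (not_lt.1 h) hμ
    exact (isGreatest_of_eq_zero P hW).csSup_eq
end
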